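/- There exists a constant c > 0 such that for all sufficiently large n the following holds. Setting m = 2^n, there exists a function f : [m] × [m] × [m] → {0,1} such that: (i) f has a 1-fooling set of size 2^n; and (ii) for every i ∈ {1,2,3} and every b ∈ {0,1}, every b-fooling set of the induced two-argument function f^i has size at most c·n. (Here f^1(x,(y,z)) = f(x,y,z), f^2(y,(x,z)) = f(x,y,z), and f^3(z,(x,y)) = f(x,y,z).) -/

import Mathlib

/-- `F` is a `b`-fooling set for the two-argument Boolean function `g`:
`g` takes the value `b` on every pair in `F`, and for any two distinct pairs
`(x_i, y_i), (x_j, y_j) ∈ F` at least one of `g(x_i, y_j)`, `g(x_j, y_i)`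
equals `1 - b`. -/
def TwoFoolingSet {α β : Type*} (g : α → β → Bool) (b : Bool)
    (F : Finset (α × β)) : Prop :=
  (∀ p ∈ F, g p.1 p.2 = b) ∧
    ∀ p ∈ F, ∀ q ∈ F, p ≠ q → g p.1 q.2 = !b ∨ g q.1 p.2 = !b

/-- `F` is a `b`-fooling set for the three-argument Boolean function `f`:
`f` takes the value `b` on every triple in `F`, and for any two distinct triples
`x ≠ z` in `F`, `f` takes the value `1 - b` on some mixture `σ^{A,B}(x,z)`
(each coordinate taken either from `x` or from `z`). -/
def ThreeFoolingSet {α : Type*} (f : α → α → α → Bool) (b : Bool)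
    (F : Finset (α × α × α)) : Prop :=
  (∀ x ∈ F, f x.1 x.2.1 x.2.2 = b) ∧
    ∀ x ∈ F, ∀ z ∈ F, x ≠ z → ∃ s₁ s₂ s₃ : Bool,
      f (cond s₁ x.1 z.1) (cond s₂ x.2.1 z.2.1) (cond s₃ x.2.2 z.2.2) = !b

open Finset

/-- Counting assignments that avoid one bad pattern on each of many disjoint pairs of positions. -/
theorem count_avoid {Ω ι : Type*} [Fintype Ω] [DecidableEq Ω] [DecidableEq ι]
    (u v : ι → Ω) (s s' : ι → Bool) (P : Finset ι)
    (h0 : ∀ p ∈ P, u p ≠ v p)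
    (h1 : ∀ p ∈ P, ∀ q ∈ P, p ≠ q → u p ≠ u q ∧ u p ≠ v q ∧ v p ≠ u q ∧ v p ≠ v q) :
    (univ.filter (fun r : Ω → Bool => ∀ p ∈ P, ¬ (r (u p) = s p ∧ r (v p) = s' p))).card
      * 4 ^ P.card ≤ 3 ^ P.card * 2 ^ Fintype.card Ω := by
  induction P using Finset.induction_on with
  | empty => simp
  | insert p P hp ih =>
    have ih' := ih (fun q hq => h0 q (mem_insert_of_mem hq))
      (fun q hq q' hq' => h1 q (mem_insert_of_mem hq) q' (mem_insert_of_mem hq'))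
    set S := univ.filter (fun r : Ω → Bool => ∀ p ∈ P, ¬ (r (u p) = s p ∧ r (v p) = s' p)) with hS
    set B := S.filter (fun r => r (u p) = s p ∧ r (v p) = s' p) with hB
    have e : univ.filter (fun r : Ω → Bool => ∀ q ∈ insert p P,
        ¬ (r (u q) = s q ∧ r (v q) = s' q))
        = S.filter (fun r => ¬ (r (u p) = s p ∧ r (v p) = s' p)) := by
      ext r
      simp only [hS, mem_filter, mem_univ, true_and, forall_mem_insert]
      exact and_comm
    have hsum := card_filter_add_card_filter_not (s := S)
      (fun r : Ω → Bool => r (u p) = s p ∧ r (v p) = s' p)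
    have huv := h0 p (mem_insert_self _ _)
    have hle : S.card ≤ (B ×ˢ (univ : Finset (Bool × Bool))).card := by
      apply card_le_card_of_injOn
        (fun r => (Function.update (Function.update r (u p) (s p)) (v p) (s' p), (r (u p), r (v p))))
      · intro r hr
        have hr' : r ∈ S := hr
        simp only [hS, mem_filter, mem_univ, true_and] at hr'
        simp only [coe_product, Set.mem_prod, mem_coe, hB, hS, mem_filter, mem_univ, true_and,
          and_true]
        refine ⟨?_, ?_, ?_⟩
        · intro q hq
          have hne : p ≠ q := fun h => hp (h ▸ hq)
          obtain ⟨a1, a2, a3, a4⟩ := h1 p (mem_insert_self _ _) q (mem_insert_of_mem hq) hne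
          rw [Function.update_of_ne a3.symm, Function.update_of_ne a1.symm,
            Function.update_of_ne a4.symm, Function.update_of_ne a2.symm]
          exact hr' q hq
        · rw [Function.update_of_ne huv, Function.update_self]
        · rw [Function.update_self]
      · intro r _ r' _ h
        simp only [Prod.mk.injEq] at h
        obtain ⟨hf, ha, hb⟩ := h
        funext x
        by_cases hx : x = v p
        · rw [hx]; exact hb
        by_cases hx' : x = u p
        · rw [hx']; exact ha
        have := congrFun hf x
        rwa [Function.update_of_ne hx, Function.update_of_ne hx', Function.update_of_ne hx,
          Function.update_of_ne hx'] at this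
    rw [card_product] at hle
    have h4 : (univ : Finset (Bool × Bool)).card = 4 := by decide
    rw [h4] at hle
    rw [e, card_insert_of_notMem hp, pow_succ, pow_succ]
    have hk : (S.filter (fun r => ¬ (r (u p) = s p ∧ r (v p) = s' p))).card * 4 ≤ 3 * S.card := by
      change B.card + _ = _ at hsum
      omega
    calc _ = ((S.filter (fun r => ¬ (r (u p) = s p ∧ r (v p) = s' p))).card * 4) * 4 ^ P.card := by
            ring
      _ ≤ (3 * S.card) * 4 ^ P.card := Nat.mul_le_mul_right _ hk
      _ = 3 * (S.card * 4 ^ P.card) := by ring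
      _ ≤ 3 * (3 ^ P.card * 2 ^ Fintype.card Ω) := Nat.mul_le_mul_left _ ih'
      _ = _ := by ring

/-- The good pairs of a candidate fooling set. -/
def goodPairs {A : Type*} [LinearOrder A] (F : Finset (A × (A × A))) :
    Finset ((A × (A × A)) × (A × (A × A))) :=
  (F ×ˢ F).filter (fun pq => pq.1.1 < pq.2.1 ∧
    (pq.1.1 ≠ pq.2.2.1 ∧ pq.1.1 ≠ pq.2.2.2) ∧ (pq.2.1 ≠ pq.1.2.1 ∧ pq.2.1 ≠ pq.1.2.2))

theorem card_goodPairs {A : Type*} [LinearOrder A] (F : Finset (A × (A × A)))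
    (hinj : ∀ p ∈ F, ∀ q ∈ F, p.1 = q.1 → p = q) :
    F.card * F.card ≤ 2 * (goodPairs F).card + 5 * F.card := by
  have key : ∀ (R : (A × (A × A)) → A), 
      ((F ×ˢ F).filter (fun pq => pq.1.1 = R pq.2)).card ≤ F.card := by
    intro R
    apply card_le_card_of_injOn (fun pq => pq.2)
    · intro pq h
      simp only [coe_filter, mem_product, Set.mem_ofPred_eq] at h
      exact h.1.2
    · rintro ⟨p, q⟩ h ⟨p', q'⟩ h' e
      simp only [coe_filter, mem_product, Set.mem_ofPred_eq] at h h' e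
      subst e
      have := hinj p h.1.1 p' h'.1.1 (h.2.trans h'.2.symm)
      rw [this]
  set B1 := (F ×ˢ F).filter (fun pq => pq.1.1 = pq.2.2.1) with hB1
  set B2 := (F ×ˢ F).filter (fun pq => pq.1.1 = pq.2.2.2) with hB2
  set D := (F ×ˢ F).filter (fun pq => pq.1.1 = pq.2.1) with hD
  have k1 : B1.card ≤ F.card := key (fun q => q.2.1)
  have k2 : B2.card ≤ F.card := key (fun q => q.2.2)
  have k3 : D.card ≤ F.card := key (fun q => q.1)
  have hsub : F ×ˢ F ⊆ (goodPairs F ∪ (goodPairs F).image Prod.swap) ∪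
      ((B1 ∪ B2) ∪ (B1.image Prod.swap ∪ B2.image Prod.swap)) ∪ D := by
    rintro ⟨p, q⟩ h
    have hpq := mem_product.1 h
    simp only at hpq
    have sw : ∀ X : Finset ((A × (A × A)) × (A × (A × A))),
        (p, q) ∈ X.image Prod.swap ↔ (q, p) ∈ X := by
      intro X
      rw [mem_image]
      constructor
      · rintro ⟨⟨a, b⟩, hab, he⟩
        simp only [Prod.swap_prod_mk, Prod.mk.injEq] at he
        rw [← he.1, ← he.2]; exact hab
      · intro hh
        exact ⟨(q, p), hh, rfl⟩
    simp only [mem_union, sw]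
    simp only [hB1, hB2, hD, goodPairs, mem_filter, mem_product, hpq, true_and, ne_eq, and_true]
    have := lt_trichotomy p.1 q.1
    tauto
  have c := card_le_card hsub
  rw [card_product] at c
  have u1 := card_union_le ((goodPairs F ∪ (goodPairs F).image Prod.swap) ∪
      ((B1 ∪ B2) ∪ (B1.image Prod.swap ∪ B2.image Prod.swap))) D
  have u2 := card_union_le (goodPairs F ∪ (goodPairs F).image Prod.swap)
      ((B1 ∪ B2) ∪ (B1.image Prod.swap ∪ B2.image Prod.swap))
  have u3 := card_union_le (goodPairs F) ((goodPairs F).image Prod.swap)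
  have u4 := card_union_le (B1 ∪ B2) (B1.image Prod.swap ∪ B2.image Prod.swap)
  have u5 := card_union_le B1 B2
  have u6 := card_union_le (B1.image Prod.swap) (B2.image Prod.swap)
  have i1 := card_image_le (s := goodPairs F) (f := Prod.swap)
  have i2 := card_image_le (s := B1) (f := Prod.swap)
  have i3 := card_image_le (s := B2) (f := Prod.swap)
  omega

/-- Injectivity facts for two-party fooling sets. -/
theorem fooling_inj {α β : Type*} {g : α → β → Bool} {b : Bool} {F : Finset (α × β)}
    (h : TwoFoolingSet g b F) :
    (∀ p ∈ F, ∀ q ∈ F, p.1 = q.1 → p = q) ∧ (∀ p ∈ F, ∀ q ∈ F, p.2 = q.2 → p = q) := by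
  constructor
  · intro p hp q hq e
    by_contra hne
    have a := h.1 p hp
    have a' := h.1 q hq
    have c := h.2 p hp q hq hne
    rw [e] at a
    rw [e, a', a] at c
    cases b <;> simp at c
  · intro p hp q hq e
    by_contra hne
    have a := h.1 p hp
    have a' := h.1 q hq
    have c := h.2 p hp q hq hne
    rw [← e] at a'
    rw [← e, a', a] at c
    cases b <;> simp at c

theorem count_one {A Ω : Type*} [LinearOrder A] [Fintype Ω] [DecidableEq Ω]
    (G : (Ω → Bool) → A → (A × A) → Bool) (s : A → (A × A) → Bool) (φ : A → (A × A) → Ω)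
    (hG : ∀ r a w, a ≠ w.1 → a ≠ w.2 → G r a w = xor (s a w) (r (φ a w)))
    (hφ : ∀ a w a' w', a ≠ w.1 → a ≠ w.2 → a' ≠ w'.1 → a' ≠ w'.2 → φ a w = φ a' w' →
      a = a' ∧ w = w')
    (b : Bool) (F : Finset (A × (A × A))) (j : ℕ)
    (hj : 2 * (3 * j) + 5 * F.card ≤ F.card * F.card)
    (S : Finset (Ω → Bool)) (hS : ∀ r ∈ S, TwoFoolingSet (G r) b F) :
    S.card * 2 ^ j ≤ 2 ^ Fintype.card Ω := by
  rcases S.eq_empty_or_nonempty with rfl | ⟨r0, hr0⟩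
  · simp
  obtain ⟨inj1, inj2⟩ := fooling_inj (hS r0 hr0)
  have hc := card_goodPairs F inj1
  obtain ⟨P, hPs, hPc⟩ := exists_subset_card_eq (s := goodPairs F) (n := 3 * j) (by omega)
  have hP : ∀ pq ∈ P, (pq.1 ∈ F ∧ pq.2 ∈ F) ∧ pq.1.1 < pq.2.1 ∧
      (pq.1.1 ≠ pq.2.2.1 ∧ pq.1.1 ≠ pq.2.2.2) ∧ (pq.2.1 ≠ pq.1.2.1 ∧ pq.2.1 ≠ pq.1.2.2) := by
    intro pq h
    have := hPs h
    simpa only [goodPairs, mem_filter, mem_product] using this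
  have hcount := count_avoid (Ω := Ω) (fun pq : (A × (A × A)) × (A × (A × A)) => φ pq.1.1 pq.2.2)
    (fun pq => φ pq.2.1 pq.1.2) (fun pq => xor (s pq.1.1 pq.2.2) b)
    (fun pq => xor (s pq.2.1 pq.1.2) b) P
    (by
      intro pq h e
      obtain ⟨_, hlt, g1, g2⟩ := hP pq h
      exact hlt.ne (hφ _ _ _ _ g1.1 g1.2 g2.1 g2.2 e).1)
    (by
      rintro ⟨p, q⟩ h ⟨p', q'⟩ h' hne
      obtain ⟨⟨m1, m2⟩, hlt, g1, g2⟩ := hP _ h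
      obtain ⟨⟨m1', m2'⟩, hlt', g1', g2'⟩ := hP _ h'
      simp only at *
      refine ⟨fun e => ?_, fun e => ?_, fun e => ?_, fun e => ?_⟩
      · obtain ⟨e1, e2⟩ := hφ _ _ _ _ g1.1 g1.2 g1'.1 g1'.2 e
        exact hne (Prod.ext (inj1 _ m1 _ m1' e1) (inj2 _ m2 _ m2' e2))
      · obtain ⟨e1, e2⟩ := hφ _ _ _ _ g1.1 g1.2 g2'.1 g2'.2 e
        have a1 := inj1 _ m1 _ m2' e1
        have a2 := inj2 _ m2 _ m1' e2
        subst a1; subst a2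
        exact lt_asymm hlt hlt'
      · obtain ⟨e1, e2⟩ := hφ _ _ _ _ g2.1 g2.2 g1'.1 g1'.2 e
        have a1 := inj1 _ m2 _ m1' e1
        have a2 := inj2 _ m1 _ m2' e2
        subst a1; subst a2
        exact lt_asymm hlt hlt'
      · obtain ⟨e1, e2⟩ := hφ _ _ _ _ g2.1 g2.2 g2'.1 g2'.2 e
        exact hne (Prod.ext (inj2 _ m1 _ m1' e2) (inj1 _ m2 _ m2' e1)))
  have hsub : S.card ≤ _ := card_le_card (t := univ.filter (fun r : Ω → Bool => ∀ pq ∈ P,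
      ¬ (r (φ pq.1.1 pq.2.2) = xor (s pq.1.1 pq.2.2) b ∧
        r (φ pq.2.1 pq.1.2) = xor (s pq.2.1 pq.1.2) b))) (by
    intro r hr
    simp only [mem_filter, mem_univ, true_and]
    rintro ⟨p, q⟩ h ⟨e1, e2⟩
    obtain ⟨⟨m1, m2⟩, hlt, g1, g2⟩ := hP _ h
    simp only at *
    have hne : p ≠ q := fun h => hlt.ne (by rw [h])
    have := (hS r hr).2 p m1 q m2 hne
    rw [hG r _ _ g1.1 g1.2, hG r _ _ g2.1 g2.2, e1, e2] at this
    simp at this)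
  have h2 := (Nat.mul_le_mul_right (4 ^ P.card) hsub).trans hcount
  rw [hPc, pow_mul, pow_mul] at h2
  norm_num at h2
  have h3 : (27 : ℕ) ^ j ≤ 32 ^ j := Nat.pow_le_pow_left (by norm_num) j
  have h4 : (64 : ℕ) ^ j = 2 ^ j * 32 ^ j := by rw [← mul_pow]; norm_num
  have h5 : (S.card * 2 ^ j) * 32 ^ j ≤ 2 ^ Fintype.card Ω * 32 ^ j := by
    calc _ = S.card * 64 ^ j := by rw [h4]; ring
      _ ≤ 27 ^ j * 2 ^ Fintype.card Ω := h2
      _ ≤ 32 ^ j * 2 ^ Fintype.card Ω := Nat.mul_le_mul_right _ h3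
      _ = _ := by ring
  exact Nat.le_of_mul_le_mul_right h5 (by positivity)

open Classical in
theorem count_all {n : ℕ} (hn : 1 ≤ n) {Ω : Type*} [Fintype Ω] [DecidableEq Ω]
    (G : (Ω → Bool) → Fin (2 ^ n) → (Fin (2 ^ n) × Fin (2 ^ n)) → Bool)
    (s : Fin (2 ^ n) → (Fin (2 ^ n) × Fin (2 ^ n)) → Bool)
    (φ : Fin (2 ^ n) → (Fin (2 ^ n) × Fin (2 ^ n)) → Ω)
    (hG : ∀ r a w, a ≠ w.1 → a ≠ w.2 → G r a w = xor (s a w) (r (φ a w)))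
    (hφ : ∀ a w a' w', a ≠ w.1 → a ≠ w.2 → a' ≠ w'.1 → a' ≠ w'.2 → φ a w = φ a' w' →
      a = a' ∧ w = w') (b : Bool) :
    (univ.filter (fun r : Ω → Bool => ∃ F : Finset (Fin (2 ^ n) × (Fin (2 ^ n) × Fin (2 ^ n))),
      F.card = 100 * n ∧ TwoFoolingSet (G r) b F)).card * 8 ≤ 2 ^ Fintype.card Ω := by
  set I := powersetCard (100 * n) (univ : Finset (Fin (2 ^ n) × (Fin (2 ^ n) × Fin (2 ^ n))))
    with hI
  have hIc : I.card ≤ 2 ^ (3 * n * (100 * n)) := by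
    rw [hI, card_powersetCard]
    refine (Nat.choose_le_pow _ _).trans (le_of_eq ?_)
    simp only [card_univ, Fintype.card_prod, Fintype.card_fin]
    rw [pow_mul 2 (3 * n)]
    congr 1
    ring
  have hsub : (univ.filter (fun r : Ω → Bool =>
      ∃ F : Finset (Fin (2 ^ n) × (Fin (2 ^ n) × Fin (2 ^ n))),
      F.card = 100 * n ∧ TwoFoolingSet (G r) b F)) ⊆
      I.biUnion (fun F => univ.filter (fun r => TwoFoolingSet (G r) b F)) := by
    intro r hr
    simp only [mem_filter, mem_univ, true_and] at hr
    obtain ⟨F, h1, h2⟩ := hr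
    simp only [mem_biUnion, mem_filter, mem_univ, true_and, hI, mem_powersetCard_univ]
    exact ⟨F, h1, h2⟩
  have hc := (card_le_card hsub).trans card_biUnion_le
  have hsum : (∑ F ∈ I, (univ.filter (fun r => TwoFoolingSet (G r) b F)).card)
      * 2 ^ (3 * n * (100 * n) + 3) ≤ I.card * 2 ^ Fintype.card Ω := by
    rw [sum_mul, ← smul_eq_mul (#I) (2 ^ Fintype.card Ω), ← sum_const]
    apply sum_le_sum
    intro F hF
    have hFc : F.card = 100 * n := by simpa [hI] using hF
    apply count_one G s φ hG hφ b F
    · rw [hFc]; nlinarith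
    · intro r hr
      simpa using hr
  set N := 2 ^ Fintype.card Ω
  have h1 : (∑ F ∈ I, (univ.filter (fun r => TwoFoolingSet (G r) b F)).card) * 8
      * 2 ^ (3 * n * (100 * n)) ≤ N * 2 ^ (3 * n * (100 * n)) := by
    calc _ = (∑ F ∈ I, (univ.filter (fun r => TwoFoolingSet (G r) b F)).card)
          * 2 ^ (3 * n * (100 * n) + 3) := by rw [pow_add]; ring
      _ ≤ I.card * N := hsum
      _ ≤ 2 ^ (3 * n * (100 * n)) * N := Nat.mul_le_mul_right _ hIc
      _ = _ := by ring
  have h2 := Nat.le_of_mul_le_mul_right h1 (by positivity)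
  exact (Nat.mul_le_mul_right 8 hc).trans h2

/-- The three-argument function built from free bits. -/
def theF {A : Type*} [LinearOrder A] (r : A × A × A → Bool) (x y z : A) : Bool :=
  if x = y ∧ y = z then true
  else if x = z ∧ x < y then !r (x, x, y) else r (x, y, z)

theorem theF_fooling {A : Type*} [LinearOrder A] [Fintype A] (r : A × A × A → Bool) :
    ThreeFoolingSet (theF r) true (univ.image (fun x : A => (x, x, x))) := by
  have key : ∀ x z : A, x < z → theF r x x z = false ∨ theF r x z x = false := by
    intro x z h
    have e1 : theF r x x z = r (x, x, z) := by simp [theF, h.ne]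
    have e2 : theF r x z x = !r (x, x, z) := by simp [theF, h.ne, h]
    rw [e1, e2]
    cases r (x, x, z) <;> simp
  constructor
  · intro x hx
    simp only [mem_image, mem_univ, true_and] at hx
    obtain ⟨a, rfl⟩ := hx
    simp [theF]
  · intro x hx z hz hne
    simp only [mem_image, mem_univ, true_and] at hx hz
    obtain ⟨a, rfl⟩ := hx
    obtain ⟨c, rfl⟩ := hz
    have hac : a ≠ c := fun h => hne (by rw [h])
    rcases lt_or_gt_of_ne hac with h | h
    · rcases key a c h with k | k
      · exact ⟨true, true, false, k⟩
      · exact ⟨true, false, true, k⟩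
    · rcases key c a h with k | k
      · exact ⟨false, false, true, k⟩
      · exact ⟨false, true, false, k⟩

theorem fooling_le {α β : Type*} {g : α → β → Bool} {b : Bool} {n : ℕ}
    (h : ¬ ∃ F : Finset (α × β), F.card = 100 * n ∧ TwoFoolingSet g b F)
    (F : Finset (α × β)) (hF : TwoFoolingSet g b F) : (F.card : ℝ) ≤ 100 * n := by
  by_contra hlt
  have : 100 * n ≤ F.card := by
    have h' : ((100 * n : ℕ) : ℝ) < F.card := by push_cast; exact not_le.1 hlt
    exact (Nat.cast_lt.1 h').le
  obtain ⟨F', hs, hc⟩ := exists_subset_card_eq this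
  exact h ⟨F', hc, fun p hp => hF.1 p (hs hp), fun p hp q hq => hF.2 p (hs hp) q (hs hq)⟩

/-- There is a constant `c > 0` such that for all sufficiently
large `n` (with `m = 2^n`) there is a function `f : [m]³ → {0,1}` having a
1-fooling set of size `2^n`, while every `b`-fooling set of each of the three
induced two-argument functions `f¹, f², f³` has size at most `c·n`. -/
theorem stmt_7 :
    ∃ c : ℝ, 0 < c ∧ ∃ N : ℕ, ∀ n ≥ N,
      ∃ f : Fin (2 ^ n) → Fin (2 ^ n) → Fin (2 ^ n) → Bool,
        (∃ F : Finset (Fin (2 ^ n) × Fin (2 ^ n) × Fin (2 ^ n)),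
          F.card = 2 ^ n ∧ ThreeFoolingSet f true F) ∧
        (∀ (b : Bool) (F : Finset (Fin (2 ^ n) × (Fin (2 ^ n) × Fin (2 ^ n)))),
          TwoFoolingSet (fun x yz => f x yz.1 yz.2) b F → (F.card : ℝ) ≤ c * n) ∧
        (∀ (b : Bool) (F : Finset (Fin (2 ^ n) × (Fin (2 ^ n) × Fin (2 ^ n)))),
          TwoFoolingSet (fun y xz => f xz.1 y xz.2) b F → (F.card : ℝ) ≤ c * n) ∧
        (∀ (b : Bool) (F : Finset (Fin (2 ^ n) × (Fin (2 ^ n) × Fin (2 ^ n)))),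
          TwoFoolingSet (fun z xy => f xy.1 xy.2 z) b F → (F.card : ℝ) ≤ c * n) := by
  classical
  refine ⟨100, by norm_num, 1, fun n hn => ?_⟩
  let G1 : ((Fin (2 ^ n) × Fin (2 ^ n) × Fin (2 ^ n)) → Bool) → Fin (2 ^ n) → Fin (2 ^ n) × Fin (2 ^ n) → Bool := fun r x yz => theF r x yz.1 yz.2
  let G2 : ((Fin (2 ^ n) × Fin (2 ^ n) × Fin (2 ^ n)) → Bool) → Fin (2 ^ n) → Fin (2 ^ n) × Fin (2 ^ n) → Bool := fun r y xz => theF r xz.1 y xz.2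
  let G3 : ((Fin (2 ^ n) × Fin (2 ^ n) × Fin (2 ^ n)) → Bool) → Fin (2 ^ n) → Fin (2 ^ n) × Fin (2 ^ n) → Bool := fun r z xy => theF r xy.1 xy.2 z
  have c1 := count_all hn G1 (fun _ _ => false) (fun a w => (a, w.1, w.2))
    (by
      rintro r a ⟨y, z⟩ h1 h2
      simp only at h1 h2
      simp [G1, theF, h1, h2])
    (by
      rintro a ⟨y, z⟩ a' ⟨y', z'⟩ _ _ _ _ e
      simpa using e)
  have c2 := count_all hn G2 (fun a w => decide (w.1 = w.2 ∧ w.1 < a))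
    (fun a w => if w.1 = w.2 ∧ w.1 < a then (w.1, w.1, a) else (w.1, a, w.2))
    (by
      rintro r a ⟨x, z⟩ h1 h2
      simp only at h1 h2
      by_cases hc : x = z ∧ x < a
      · obtain ⟨rfl, hlt⟩ := hc
        simp [G2, theF, h1.symm, hlt]
      · simp [G2, theF, h1.symm, hc])
    (by
      rintro a ⟨y, z⟩ a' ⟨y', z'⟩ h1 h2 h3 h4 e
      simp only at *
      split_ifs at e <;> simp only [Prod.mk.injEq] at e ⊢ <;> grind)
  have c3 := count_all hn G3 (fun _ _ => false) (fun a w => (w.1, w.2, a))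
    (by
      rintro r a ⟨x, y⟩ h1 h2
      simp only at h1 h2
      simp [G3, theF, h1.symm, h2.symm])
    (by
      rintro a ⟨y, z⟩ a' ⟨y', z'⟩ _ _ _ _ e
      simp only [Prod.mk.injEq] at e ⊢
      tauto)
  let X : (((Fin (2 ^ n) × Fin (2 ^ n) × Fin (2 ^ n)) → Bool) → Fin (2 ^ n) → Fin (2 ^ n) × Fin (2 ^ n) → Bool) → Bool → Finset ((Fin (2 ^ n) × Fin (2 ^ n) × Fin (2 ^ n)) → Bool) := fun G b =>
    univ.filter (fun r : (Fin (2 ^ n) × Fin (2 ^ n) × Fin (2 ^ n)) → Bool => ∃ F : Finset (Fin (2 ^ n) × (Fin (2 ^ n) × Fin (2 ^ n))),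
      F.card = 100 * n ∧ TwoFoolingSet (G r) b F)
  have d1 : ∀ b, (X G1 b).card * 8 ≤ 2 ^ Fintype.card (Fin (2 ^ n) × Fin (2 ^ n) × Fin (2 ^ n)) := fun b => by convert c1 b
  have d2 : ∀ b, (X G2 b).card * 8 ≤ 2 ^ Fintype.card (Fin (2 ^ n) × Fin (2 ^ n) × Fin (2 ^ n)) := fun b => by convert c2 b
  have d3 : ∀ b, (X G3 b).card * 8 ≤ 2 ^ Fintype.card (Fin (2 ^ n) × Fin (2 ^ n) × Fin (2 ^ n)) := fun b => by convert c3 b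
  obtain ⟨r, hr⟩ : ∃ r : (Fin (2 ^ n) × Fin (2 ^ n) × Fin (2 ^ n)) → Bool, r ∉ ((X G1 true ∪ X G1 false) ∪ (X G2 true ∪ X G2 false)) ∪
      (X G3 true ∪ X G3 false) := by
    by_contra! hall
    have hu := eq_univ_iff_forall.2 hall
    have hc := congrArg Finset.card hu
    rw [card_univ, Fintype.card_fun, Fintype.card_bool] at hc
    have u1 := card_union_le ((X G1 true ∪ X G1 false) ∪ (X G2 true ∪ X G2 false))
      (X G3 true ∪ X G3 false)
    have u2 := card_union_le (X G1 true ∪ X G1 false) (X G2 true ∪ X G2 false)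
    have u3 := card_union_le (X G1 true) (X G1 false)
    have u4 := card_union_le (X G2 true) (X G2 false)
    have u5 := card_union_le (X G3 true) (X G3 false)
    have hpos : 0 < 2 ^ Fintype.card (Fin (2 ^ n) × Fin (2 ^ n) × Fin (2 ^ n)) := by positivity
    have := d1 true
    have := d1 false
    have := d2 true
    have := d2 false
    have := d3 true
    have := d3 false
    omega
  simp only [mem_union, not_or] at hr
  obtain ⟨⟨⟨r1, r2⟩, ⟨r3, r4⟩⟩, ⟨r5, r6⟩⟩ := hr
  have q1 : ∀ b, r ∉ X G1 b := fun b => match b with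
    | true => r1
    | false => r2
  have q2 : ∀ b, r ∉ X G2 b := fun b => match b with
    | true => r3
    | false => r4
  have q3 : ∀ b, r ∉ X G3 b := fun b => match b with
    | true => r5
    | false => r6
  have w : ∀ G b, r ∉ X G b → ∀ F : Finset (Fin (2 ^ n) × (Fin (2 ^ n) × Fin (2 ^ n))),
      TwoFoolingSet (G r) b F → (F.card : ℝ) ≤ 100 * n := by
    intro G b hX F hF
    refine fooling_le (g := G r) (b := b) ?_ F hF
    intro hex
    exact hX (mem_filter.2 ⟨mem_univ _, hex⟩)
  have hcard : (univ.image (fun x : Fin (2 ^ n) => (x, x, x))).card = 2 ^ n := by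
    rw [card_image_of_injective _ (fun a b h => (Prod.mk.inj h).1), card_univ, Fintype.card_fin]
  have hfool := theF_fooling r
  refine ⟨theF r, ⟨univ.image (fun x : Fin (2 ^ n) => (x, x, x)), ?_, ?_⟩, ?_, ?_, ?_⟩
  · convert hcard
  · convert hfool
  · exact fun b F hF => w G1 b (q1 b) F hF
  · exact fun b F hF => w G2 b (q2 b) F hF
  · exact fun b F hF => w G3 b (q3 b) F hF
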